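/- The map sending a ternary tree T to the word φ(T) defined recursively by φ(empty) = empty word and φ(node(A,B,C)) = B₁ · φ(A) · H · B₂ · U · φ(C) · D, where φ(B) = B₁ · B₂ with B₁ the prefix of φ(B) ending at its last U step (B₁ empty if φ(B) has no U), is injective from ternary trees with n nodes into words over {H,U,D} of length 3n. -/

import Mathlib

/-- The three step types of a Motzkin path: H = (1,0), U = (1,1), D = (1,-1). -/
inductive Step : Type | H | U | D
deriving DecidableEq, Repr

/-- A ternary tree: either empty, or a node with left, middle and right subtrees. -/
inductive TernaryTree : Type
  | leaf : TernaryTree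
  | node : TernaryTree → TernaryTree → TernaryTree → TernaryTree

/-- The number of nodes of a ternary tree. -/
def TernaryTree.size : TernaryTree → ℕ
  | .leaf => 0
  | .node a b c => 1 + a.size + b.size + c.size

/-- The prefix of w ending at the last U step of w (empty if w has no U). -/
def firstPart (w : List Step) : List Step :=
  (w.reverse.dropWhile (fun s => s != Step.U)).reverse

/-- The suffix of w after its last U step (all of w if w has no U). -/
def secondPart (w : List Step) : List Step :=
  (w.reverse.takeWhile (fun s => s != Step.U)).reverse

/-- The recursive map from ternary trees to words over {H, U, D}:
φ(empty) = ε and φ(node(A,B,C)) = B₁ · φ(A) · H · B₂ · U · φ(C) · D,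
where φ(B) = B₁ · B₂ is split at the last U of φ(B). -/
def phi : TernaryTree → List Step
  | .leaf => []
  | .node a b c =>
      firstPart (phi b) ++ phi a ++ Step.H ::
        (secondPart (phi b) ++ Step.U :: (phi c ++ [Step.D]))

/-- Height change of a step. -/
def stepHt : Step → ℤ
  | .H => 0
  | .U => 1
  | .D => -1

/-- Total height change of a word. -/
def wordHt : List Step → ℤ
  | [] => 0
  | s :: w => stepHt s + wordHt w

/-- The path w started at height n stays weakly above zero. -/
def StaysNonneg : ℤ → List Step → Prop
  | n, [] => 0 ≤ n
  | n, s :: w => 0 ≤ n ∧ StaysNonneg (n + stepHt s) w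

theorem wordHt_append (x y : List Step) : wordHt (x ++ y) = wordHt x + wordHt y := by
  induction x with
  | nil => simp [wordHt]
  | cons s x ih => simp only [List.cons_append, wordHt, ih]; ring

theorem wordHt_replicate (k : ℕ) : wordHt (List.replicate k Step.D) = -(k : ℤ) := by
  induction k with
  | zero => simp [wordHt]
  | succ k ih => simp only [List.replicate_succ, wordHt, ih, stepHt]; push_cast; ring

theorem StaysNonneg.start {n : ℤ} {w : List Step} (h : StaysNonneg n w) : 0 ≤ n := by
  cases w with
  | nil => exact h
  | cons s w => exact h.1

theorem staysNonneg_append (x y : List Step) (n : ℤ) :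
    StaysNonneg n (x ++ y) ↔ StaysNonneg n x ∧ StaysNonneg (n + wordHt x) y := by
  induction x generalizing n with
  | nil =>
    simp only [List.nil_append, StaysNonneg, wordHt, add_zero]
    exact ⟨fun h => ⟨h.start, h⟩, fun h => h.2⟩
  | cons s x ih =>
    simp only [List.cons_append, StaysNonneg, wordHt, ih, and_assoc, add_assoc]

theorem StaysNonneg.mono {w : List Step} {n m : ℤ} (h : StaysNonneg n w) (hnm : n ≤ m) :
    StaysNonneg m w := by
  induction w generalizing n m with
  | nil => exact le_trans h hnm
  | cons s w ih => exact ⟨le_trans h.1 hnm, ih h.2 (by linarith)⟩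

theorem split_unique_aux {x y z y' : List Step} (hx : wordHt (x ++ z) = wordHt x)
    (hy : StaysNonneg 0 y) (h : Step.U :: y = z ++ Step.U :: y') : z = [] := by
  cases z with
  | nil => rfl
  | cons s z =>
    exfalso
    simp only [List.cons_append, List.cons.injEq] at h
    obtain ⟨rfl, rfl⟩ := h
    have h1 := ((staysNonneg_append _ _ _).1 hy).2.start
    rw [wordHt_append] at hx
    simp only [wordHt, stepHt] at hx
    linarith

theorem split_unique {x y x' y' : List Step} (hx : wordHt x = wordHt x')
    (hy : StaysNonneg 0 y) (hy' : StaysNonneg 0 y')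
    (h : x ++ Step.U :: y = x' ++ Step.U :: y') : x = x' ∧ y = y' := by
  rcases List.append_eq_append_iff.1 h with ⟨z, h1, h2⟩ | ⟨z, h1, h2⟩
  · have hz := split_unique_aux (x := x) (z := z) (by rw [← h1, hx]) hy h2
    subst hz
    simp at h1 h2
    exact ⟨h1.symm, h2⟩
  · have hz := split_unique_aux (x := x') (z := z) (by rw [← h1, hx]) hy' h2
    subst hz
    simp at h1 h2
    exact ⟨h1, h2.symm⟩

theorem tail_unique {q q' : List Step} {k k' : ℕ}
    (h : q ++ Step.H :: List.replicate k Step.D = q' ++ Step.H :: List.replicate k' Step.D) :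
    q = q' ∧ k = k' := by
  have h2 := congrArg List.reverse h
  simp only [List.reverse_append, List.reverse_cons, List.reverse_replicate, List.append_assoc,
    List.cons_append, List.nil_append] at h2
  suffices hs : ∀ (p p' : List Step) (k k' : ℕ),
      List.replicate k Step.D ++ Step.H :: p = List.replicate k' Step.D ++ Step.H :: p' →
      p = p' ∧ k = k' by
    obtain ⟨h3, h4⟩ := hs _ _ _ _ h2
    exact ⟨List.reverse_injective h3, h4⟩
  intro p p' k
  induction k with
  | zero =>
    intro k' h
    cases k' with
    | zero => simpa using h
    | succ k' => simp [List.replicate_succ] at h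
  | succ k ih =>
    intro k' h
    cases k' with
    | zero => simp [List.replicate_succ] at h
    | succ k' =>
      simp only [List.replicate_succ, List.cons_append, List.cons.injEq, true_and] at h
      obtain ⟨h3, h4⟩ := ih k' h
      exact ⟨h3, by rw [h4]⟩

theorem parts_append (w : List Step) : firstPart w ++ secondPart w = w := by
  unfold firstPart secondPart
  rw [← List.reverse_append, List.takeWhile_append_dropWhile, List.reverse_reverse]

theorem takeWhile_aux (k : ℕ) (x : List Step) :
    (List.replicate k Step.D ++ Step.U :: x).takeWhile (fun s => s != Step.U)
      = List.replicate k Step.D := by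
  induction k with
  | zero => simp
  | succ k ih => simp [List.replicate_succ, ih]

theorem secondPart_eq (x : List Step) (k : ℕ) :
    secondPart (x ++ Step.U :: List.replicate k Step.D) = List.replicate k Step.D := by
  simp [secondPart, takeWhile_aux]

theorem firstPart_eq (x : List Step) (k : ℕ) :
    firstPart (x ++ Step.U :: List.replicate k Step.D) = x ++ [Step.U] := by
  have h := parts_append (x ++ Step.U :: List.replicate k Step.D)
  rw [secondPart_eq] at h
  have h2 : x ++ Step.U :: List.replicate k Step.D
    = (x ++ [Step.U]) ++ List.replicate k Step.D := by simp
  rw [h2] at h ⊢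
  exact List.append_cancel_right h

theorem phi_shape (t : TernaryTree) :
    t = .leaf ∨ ∃ x k, phi t = x ++ Step.U :: List.replicate (k + 1) Step.D := by
  induction t with
  | leaf => exact Or.inl rfl
  | node a b c _ _ ihc =>
    right
    rcases ihc with rfl | ⟨x, k, h⟩
    · exact ⟨firstPart (phi b) ++ phi a ++ Step.H :: secondPart (phi b), 0, by simp [phi]⟩
    · refine ⟨firstPart (phi b) ++ phi a ++ Step.H ::
        (secondPart (phi b) ++ Step.U :: x), k + 1, ?_⟩
      rw [phi, h, List.replicate_succ' (n := k + 1)]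
      simp

theorem phi_ht (t : TernaryTree) : wordHt (phi t) = 0 := by
  induction t with
  | leaf => rfl
  | node a b c iha ihb ihc =>
    rw [← parts_append (phi b)] at ihb
    simp only [wordHt_append] at ihb
    simp only [phi, wordHt_append, wordHt, stepHt, iha, ihc]
    linarith

theorem phi_nonneg (t : TernaryTree) : StaysNonneg 0 (phi t) := by
  induction t with
  | leaf => exact le_refl _
  | node a b c iha ihb ihc =>
    have hb := phi_ht b
    rw [← parts_append (phi b)] at ihb hb
    rw [wordHt_append] at hb
    rw [staysNonneg_append] at ihb
    obtain ⟨h1, h2⟩ := ihb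
    have h0 := h2.start
    simp only [phi, staysNonneg_append, StaysNonneg, wordHt_append, wordHt, stepHt, phi_ht]
    refine ⟨⟨h1, iha.mono h0⟩, by linarith, h2.mono (by linarith), by linarith,
      ihc.mono (by linarith), by linarith, by linarith⟩

theorem phi_node_shape (a b c : TernaryTree) :
    ∃ q k, phi (.node a b c)
        = ((q ++ Step.H :: List.replicate k Step.D) ++ Step.U :: phi c) ++ [Step.D] ∧
      wordHt (q ++ Step.H :: List.replicate k Step.D) = 0 ∧
      ((k = 0 ∧ b = .leaf ∧ q = phi a) ∨
        ∃ x, 0 < k ∧ phi b = x ++ Step.U :: List.replicate k Step.D ∧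
          q = x ++ Step.U :: phi a ∧ wordHt x = k - 1) := by
  rcases phi_shape b with rfl | ⟨x, k, h⟩
  · refine ⟨phi a, 0, ?_, ?_, Or.inl ⟨rfl, rfl, rfl⟩⟩
    · simp [phi, firstPart, secondPart]
    · simp [wordHt_append, wordHt, stepHt, phi_ht]
  · have hb := phi_ht b
    rw [h] at hb
    simp only [wordHt_append, wordHt, stepHt, wordHt_replicate] at hb
    refine ⟨x ++ Step.U :: phi a, k + 1, ?_, ?_, Or.inr ⟨x, by omega, h, rfl, by linarith⟩⟩
    · rw [phi, h, firstPart_eq, secondPart_eq]; simp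
    · simp only [wordHt_append, wordHt, stepHt, wordHt_replicate, phi_ht]
      linarith

theorem phi_inj (t t' : TernaryTree) (h : phi t = phi t') : t = t' := by
  induction t generalizing t' with
  | leaf =>
    cases t' with
    | leaf => rfl
    | node a b c => simp [phi] at h
  | node a b c iha ihb ihc =>
    cases t' with
    | leaf => simp [phi] at h
    | node a' b' c' =>
      obtain ⟨q, k, h1, h2, h3⟩ := phi_node_shape a b c
      obtain ⟨q', k', h1', h2', h3'⟩ := phi_node_shape a' b' c'
      rw [h1, h1'] at h
      have h4 := List.append_cancel_right h
      obtain ⟨h5, h6⟩ := split_unique (h2.trans h2'.symm) (phi_nonneg c) (phi_nonneg c') h4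
      obtain ⟨hq, hk⟩ := tail_unique h5
      have hc := ihc _ h6
      subst hk
      rcases h3 with ⟨k0, hb, ha⟩ | ⟨x, k0, hb, ha, hx⟩ <;>
        rcases h3' with ⟨k0', hb', ha'⟩ | ⟨x', k0', hb', ha', hx'⟩
      · rw [hc, hb, hb', iha a' (by rw [← ha, ← ha', hq])]
      · omega
      · omega
      · obtain ⟨h7, h8⟩ := split_unique (hx.trans hx'.symm) (phi_nonneg a) (phi_nonneg a')
          (by rw [← ha, ← ha', hq])
        rw [hc, iha _ h8, ihb b' (by rw [hb, hb', h7])]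

theorem phi_length (t : TernaryTree) : (phi t).length = 3 * t.size := by
  induction t with
  | leaf => rfl
  | node a b c iha ihb ihc =>
    rw [← parts_append (phi b), List.length_append] at ihb
    simp only [phi, TernaryTree.size, List.length_append, List.length_cons, List.length_nil, iha,
      ihc]
    omega

theorem phi_injective :
    Function.Injective phi ∧ ∀ T : TernaryTree, (phi T).length = 3 * T.size := by
  exact ⟨fun t t' h => phi_inj t t' h, phi_length⟩
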